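/- Let d ≥ 3, n ≥ 4, and consider the homogeneous polynomial in n variables over ℂ given by f = x_1^d + ⋯ + x_{n−2}^d − (1/(n−2)^{d−1})(x_1 + ⋯ + x_{n−2})^d. Then for all s, t ∈ ℂ the point (1, 1, …, 1, s, t) ∈ ℂ^n (first n − 2 coordinates equal to 1) is a singular point of f; in particular f has infinitely many singular points in P^{n−1}(ℂ). -/

import Mathlib

open MvPolynomial

theorem stmt13_aux {n d : ℕ} (hn : 4 ≤ n) 
    (v : Fin n → ℂ) (c : ℂ) (hv : ∀ i : Fin n, (i : ℕ) < n - 2 → v i = c) (i : Fin n) :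
    eval v (pderiv i ((∑ i : Fin (n - 2), (X (Fin.castLE (Nat.sub_le n 2) i) :
          MvPolynomial (Fin n) ℂ) ^ d)
        - C ((1 : ℂ) / (n - 2 : ℕ) ^ (d - 1))
          * (∑ i : Fin (n - 2), (X (Fin.castLE (Nat.sub_le n 2) i) :
              MvPolynomial (Fin n) ℂ)) ^ d)) = 0 := by
  have hm : ((n - 2 : ℕ) : ℂ) ≠ 0 := by
    have : n - 2 ≠ 0 := by omega
    exact_mod_cast this
  have hv' : ∀ j : Fin (n - 2), v (Fin.castLE (Nat.sub_le n 2) j) = c :=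
    fun j => hv _ (by simp)
  simp only [map_sub, map_sum, pderiv_C_mul, pderiv_pow, map_mul, map_pow, eval_X, hv', eval_C,
    map_natCast, Finset.sum_const, Finset.card_univ, Fintype.card_fin, nsmul_eq_mul,
    smul_eval, ← Finset.mul_sum, mul_pow]
  field_simp
  ring

theorem stmt13 {n d : ℕ} (hn : 4 ≤ n) (hd : 3 ≤ d)
    (f : MvPolynomial (Fin n) ℂ)
    (hf : f = (∑ i : Fin (n - 2), (X (Fin.castLE (Nat.sub_le n 2) i) :
          MvPolynomial (Fin n) ℂ) ^ d)
        - C ((1 : ℂ) / (n - 2 : ℕ) ^ (d - 1))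
          * (∑ i : Fin (n - 2), (X (Fin.castLE (Nat.sub_le n 2) i) :
              MvPolynomial (Fin n) ℂ)) ^ d) :
    (∀ s t : ℂ,
      (fun i : Fin n => if (i : ℕ) < n - 2 then (1 : ℂ)
          else if (i : ℕ) = n - 2 then s else t) ≠ 0 ∧
      ∀ i, eval (fun i : Fin n => if (i : ℕ) < n - 2 then (1 : ℂ)
          else if (i : ℕ) = n - 2 then s else t) (pderiv i f) = 0) ∧
    {x : Projectivization ℂ (Fin n → ℂ) | ∀ i, eval x.rep (pderiv i f) = 0}.Infinite := by
  subst hf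
  have hne : ∀ s t : ℂ, (fun i : Fin n => if (i : ℕ) < n - 2 then (1 : ℂ)
          else if (i : ℕ) = n - 2 then s else t) ≠ 0 := by
    intro s t h
    have h0 := congrFun h ⟨0, by omega⟩
    have : 0 < n - 2 := by omega
    simp [this] at h0
  refine ⟨fun s t => ⟨hne s t, fun i => stmt13_aux hn _ 1 (fun j hj => by simp [hj]) i⟩, ?_⟩
  refine Set.infinite_of_injective_forall_mem
    (f := fun s : ℂ => Projectivization.mk ℂ _ (hne s 0)) ?_ ?_
  · intro s t h
    obtain ⟨a, ha⟩ := (Projectivization.mk_eq_mk_iff ℂ _ _ (hne s 0) (hne t 0)).1 h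
    have h0 := congrFun ha ⟨0, by omega⟩
    have h1 := congrFun ha ⟨n - 2, by omega⟩
    have h2 : 0 < n - 2 := by omega
    simp only [Pi.smul_apply, Units.smul_def, smul_eq_mul, h2, if_true, lt_irrefl, if_false,
      mul_one] at h0 h1
    rw [h0, one_mul] at h1
    exact h1.symm
  · intro s i
    obtain ⟨a, ha⟩ := Projectivization.exists_smul_eq_mk_rep ℂ _ (hne s 0)
    refine stmt13_aux hn _ (a : ℂ) (fun j hj => ?_) i
    rw [← ha]
    simp [hj, Units.smul_def]
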